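/- Let G be a finite group, let B be a Rota–Baxter operator on G, and let c be an element of the center of G. Then the order of B(c) divides the order of c. -/

import Mathlib

/-- A Rota–Baxter operator of weight 1 on a group. -/
def IsRotaBaxter {G : Type*} [Group G] (B : G → G) : Prop :=
  ∀ g h : G, B g * B h = B (g * B g * h * (B g)⁻¹)

/-- A splitting Rota–Baxter operator: comes from an exact factorization G = HL. -/
def IsSplitting {G : Type*} [Group G] (B : G → G) : Prop :=
  ∃ H L : Subgroup G, H ⊓ L = ⊥ ∧ (∀ g : G, ∃ h ∈ H, ∃ l ∈ L, g = h * l) ∧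
    (∀ h ∈ H, ∀ l ∈ L, B (h * l) = l⁻¹)

/-- The companion Rota–Baxter operator B̃(g) = g⁻¹ · B(g⁻¹). -/
def tilde {G : Type*} [Group G] (B : G → G) : G → G := fun g => g⁻¹ * B g⁻¹

namespace IsRotaBaxter

variable {G : Type*} [Group G] {B : G → G}

theorem map_one (hB : IsRotaBaxter B) : B 1 = 1 := by
  simpa using hB 1 1

theorem map_mul_of_mem_center (hB : IsRotaBaxter B) (g : G) {c : G}
    (hc : c ∈ Subgroup.center G) : B (g * c) = B g * B c := by
  rw [hB g c, mul_assoc (g * B g), ← Subgroup.mem_center_iff.mp hc, ← mul_assoc,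
    mul_inv_cancel_right]

theorem map_pow_of_mem_center (hB : IsRotaBaxter B) {c : G}
    (hc : c ∈ Subgroup.center G) (n : ℕ) : B (c ^ n) = B c ^ n := by
  induction n with
  | zero => simp [hB.map_one]
  | succ n ih => rw [pow_succ, pow_succ, hB.map_mul_of_mem_center _ hc, ih]

end IsRotaBaxter

/-- If B is a Rota–Baxter operator on a finite group G and c is central,
then the order of B(c) divides the order of c. -/
theorem stmt8 {G : Type*} [Group G] [Finite G] (B : G → G) (hB : IsRotaBaxter B)
    (c : G) (hc : c ∈ Subgroup.center G) :
    orderOf (B c) ∣ orderOf c := by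
  rw [orderOf_dvd_iff_pow_eq_one, ← hB.map_pow_of_mem_center hc, pow_orderOf_eq_one, hB.map_one]
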